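/- There exists a constant c > 0, depending only on μ and γ₋, such that for every x ∈ (0,1] one has ∫₀ˣ ( ∫_{(0,1]} τ^{1−α} dμ(α) )^{−1} dτ ≤ c · ( ∫_{(0,1]} x^{−α} dμ(α) )^{−1}. -/

import Mathlib

open MeasureTheory Real

/-- `μ` is a nonzero distributed-order measure supported in `(0,1]`: it has the form
`Σₙ qₙ δ_{αₙ} + w·(Lebesgue on (0,1))` with `0 < α₁ < ⋯ < α_M < 1`, `qₙ ≥ 0`, and a
nonnegative weight `w ∈ L¹((0,1))` (either part may vanish, but `μ ≠ 0`). -/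
def IsDistOrderMeasure (μ : Measure ℝ) : Prop :=
  μ ≠ 0 ∧
  ∃ (M : ℕ) (α : Fin M → ℝ) (q : Fin M → ℝ) (w : ℝ → ℝ),
    StrictMono α ∧ (∀ n, α n ∈ Set.Ioo (0:ℝ) 1) ∧ (∀ n, 0 ≤ q n) ∧
    (∀ x ∈ Set.Ioo (0:ℝ) 1, 0 ≤ w x) ∧
    MeasureTheory.IntegrableOn w (Set.Ioo 0 1) ∧
    μ = (∑ n, ENNReal.ofReal (q n) • MeasureTheory.Measure.dirac (α n)) +
        ((MeasureTheory.volume.restrict (Set.Ioo (0:ℝ) 1)).withDensity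
          fun x => ENNReal.ofReal (w x))

/-- The function `a ↦ t ^ (-a)` is integrable on `(0,1]` for a finite measure. -/
theorem integrableOn_rpow_neg (μ : Measure ℝ) [IsFiniteMeasure μ] {t : ℝ}
    (ht : t ∈ Set.Ioc (0:ℝ) 1) : IntegrableOn (fun a => t ^ (-a)) (Set.Ioc (0:ℝ) 1) μ := by
  refine Measure.integrableOn_of_bounded (M := t⁻¹) (measure_ne_top _ _) ?_ ?_
  · exact (continuous_const.rpow continuous_neg
      fun _ => Or.inl ht.1.ne').aestronglyMeasurable
  · refine (ae_restrict_iff' measurableSet_Ioc).2 (.of_forall fun a ha => ?_)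
    rw [norm_of_nonneg (rpow_nonneg ht.1.le _), ← rpow_neg_one]
    exact rpow_le_rpow_of_exponent_ge ht.1 ht.2 (by linarith [ha.2])

/-- The part of the symbol carried by exponents above `γ` controls the whole symbol. -/
theorem setIntegral_rpow_neg_le_mul (μ : Measure ℝ) [IsFiniteMeasure μ] {γ : ℝ}
    (hγ : γ ∈ Set.Ioo (0:ℝ) 1) (hγμ : 0 < μ (Set.Ioc γ 1)) {x : ℝ}
    (hx : x ∈ Set.Ioc (0:ℝ) 1) :
    ∫ a in Set.Ioc (0:ℝ) 1, x ^ (-a) ∂μ ≤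
      (μ.real (Set.Ioc 0 γ) / μ.real (Set.Ioc γ 1) + 1) *
        ∫ a in Set.Ioc γ 1, x ^ (-a) ∂μ := by
  have hm : 0 < μ.real (Set.Ioc γ 1) := ENNReal.toReal_pos hγμ.ne' (measure_ne_top _ _)
  have hint := integrableOn_rpow_neg μ hx
  have hlow := hint.mono_set (Set.Ioc_subset_Ioc_right hγ.2.le)
  have hhigh := hint.mono_set (Set.Ioc_subset_Ioc_left hγ.1.le)
  have hA : ∫ a in Set.Ioc 0 γ, x ^ (-a) ∂μ ≤ μ.real (Set.Ioc 0 γ) * x ^ (-γ) := by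
    rw [← smul_eq_mul, ← setIntegral_const]
    exact setIntegral_mono_on hlow (integrable_const _) measurableSet_Ioc fun a ha =>
      rpow_le_rpow_of_exponent_ge hx.1 hx.2 (by linarith [ha.2])
  have hB : μ.real (Set.Ioc γ 1) * x ^ (-γ) ≤ ∫ a in Set.Ioc γ 1, x ^ (-a) ∂μ := by
    rw [← smul_eq_mul, ← setIntegral_const]
    exact setIntegral_mono_on (integrable_const _) hhigh measurableSet_Ioc fun a ha =>
      rpow_le_rpow_of_exponent_ge hx.1 hx.2 (by linarith [ha.1])
  have hsplit : ∫ a in Set.Ioc (0:ℝ) 1, x ^ (-a) ∂μ =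
      (∫ a in Set.Ioc 0 γ, x ^ (-a) ∂μ) + ∫ a in Set.Ioc γ 1, x ^ (-a) ∂μ := by
    rw [← Set.Ioc_union_Ioc_eq_Ioc hγ.1.le hγ.2.le]
    exact setIntegral_union (Set.Ioc_disjoint_Ioc_of_le le_rfl) measurableSet_Ioc hlow hhigh
  have hC : μ.real (Set.Ioc 0 γ) * x ^ (-γ) ≤
      μ.real (Set.Ioc 0 γ) / μ.real (Set.Ioc γ 1) * ∫ a in Set.Ioc γ 1, x ^ (-a) ∂μ := by
    calc μ.real (Set.Ioc 0 γ) * x ^ (-γ)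
        = μ.real (Set.Ioc 0 γ) / μ.real (Set.Ioc γ 1) *
            (μ.real (Set.Ioc γ 1) * x ^ (-γ)) := by field_simp
      _ ≤ _ := by gcongr
  linarith

theorem setIntegral_rpow_neg_pos (μ : Measure ℝ) [IsFiniteMeasure μ] {γ : ℝ}
    (hγ : γ ∈ Set.Ioo (0:ℝ) 1) (hγμ : 0 < μ (Set.Ioc γ 1)) {x : ℝ}
    (hx : x ∈ Set.Ioc (0:ℝ) 1) : 0 < ∫ a in Set.Ioc (0:ℝ) 1, x ^ (-a) ∂μ := by
  have hsub : Set.Ioc γ 1 ⊆ Set.Ioc (0:ℝ) 1 := Set.Ioc_subset_Ioc_left hγ.1.le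
  rw [setIntegral_pos_iff_support_of_nonneg_ae (.of_forall fun a => rpow_nonneg hx.1.le _)
    (integrableOn_rpow_neg μ hx)]
  exact hγμ.trans_le (measure_mono fun a ha => ⟨(rpow_pos_of_pos hx.1 _).ne', hsub ha⟩)

/-- The symbol grows at least like `τ ^ (-γ)` towards `0`, up to a constant. -/
theorem rpow_mul_setIntegral_rpow_neg_le (μ : Measure ℝ) [IsFiniteMeasure μ] {γ : ℝ}
    (hγ : γ ∈ Set.Ioo (0:ℝ) 1) (hγμ : 0 < μ (Set.Ioc γ 1)) {τ x : ℝ}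
    (hx : x ∈ Set.Ioc (0:ℝ) 1) (hτ : τ ∈ Set.Ioc 0 x) :
    (x / τ) ^ γ * ∫ a in Set.Ioc (0:ℝ) 1, x ^ (-a) ∂μ ≤
      (μ.real (Set.Ioc 0 γ) / μ.real (Set.Ioc γ 1) + 1) *
        ∫ a in Set.Ioc (0:ℝ) 1, τ ^ (-a) ∂μ := by
  have hτ1 : τ ∈ Set.Ioc (0:ℝ) 1 := ⟨hτ.1, hτ.2.trans hx.2⟩
  have hsub : Set.Ioc γ 1 ⊆ Set.Ioc (0:ℝ) 1 := Set.Ioc_subset_Ioc_left hγ.1.le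
  have hdiv : 1 ≤ x / τ := (one_le_div hτ.1).2 hτ.2
  have hscale : (x / τ) ^ γ * ∫ a in Set.Ioc γ 1, x ^ (-a) ∂μ ≤
      ∫ a in Set.Ioc (0:ℝ) 1, τ ^ (-a) ∂μ := by
    rw [← integral_const_mul]
    refine (setIntegral_mono_on (((integrableOn_rpow_neg μ hx).mono_set hsub).const_mul _)
      ((integrableOn_rpow_neg μ hτ1).mono_set hsub) measurableSet_Ioc fun a ha => ?_).trans
      (setIntegral_mono_set (integrableOn_rpow_neg μ hτ1)
        (.of_forall fun a => rpow_nonneg hτ.1.le _) hsub.eventuallyLE)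
    calc (x / τ) ^ γ * x ^ (-a) ≤ (x / τ) ^ a * x ^ (-a) :=
          mul_le_mul_of_nonneg_right (rpow_le_rpow_of_exponent_le hdiv ha.1.le)
            (rpow_nonneg hx.1.le _)
      _ = τ ^ (-a) := by
          have := (rpow_pos_of_pos hx.1 a).ne'
          rw [div_rpow hx.1.le hτ.1.le, rpow_neg hx.1.le, rpow_neg hτ.1.le]
          field_simp
  calc (x / τ) ^ γ * ∫ a in Set.Ioc (0:ℝ) 1, x ^ (-a) ∂μ
      ≤ (x / τ) ^ γ * ((μ.real (Set.Ioc 0 γ) / μ.real (Set.Ioc γ 1) + 1) *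
          ∫ a in Set.Ioc γ 1, x ^ (-a) ∂μ) :=
        mul_le_mul_of_nonneg_left (setIntegral_rpow_neg_le_mul μ hγ hγμ hx)
          (rpow_nonneg (zero_le_one.trans hdiv) _)
    _ = (μ.real (Set.Ioc 0 γ) / μ.real (Set.Ioc γ 1) + 1) *
          ((x / τ) ^ γ * ∫ a in Set.Ioc γ 1, x ^ (-a) ∂μ) := by ring
    _ ≤ _ := by gcongr

theorem setIntegral_rpow_one_sub (μ : Measure ℝ) {τ : ℝ} (hτ : 0 < τ) :
    ∫ a in Set.Ioc (0:ℝ) 1, τ ^ (1 - a) ∂μ = τ * ∫ a in Set.Ioc (0:ℝ) 1, τ ^ (-a) ∂μ := by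
  rw [← integral_const_mul]
  congr 1 with a
  rw [sub_eq_add_neg, rpow_add hτ, rpow_one]

/-- There exists `c > 0`, depending only on `μ` and `γ₋`, such that for every `x ∈ (0,1]`,
`∫₀ˣ (∫_{(0,1]} τ^{1−α} dμ(α))^{−1} dτ ≤ c · (∫_{(0,1]} x^{−α} dμ(α))^{−1}`. -/
theorem statement11 (μ : Measure ℝ) [IsFiniteMeasure μ] (hμ : IsDistOrderMeasure μ)
    (γ : ℝ) (hγ : γ ∈ Set.Ioo (0:ℝ) 1) (hγμ : 0 < μ (Set.Ioc γ 1)) :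
    ∃ c : ℝ, 0 < c ∧ ∀ x ∈ Set.Ioc (0:ℝ) 1,
      (∫ τ in (0:ℝ)..x, (∫ a in Set.Ioc (0:ℝ) 1, τ ^ (1 - a) ∂μ)⁻¹) ≤
        c * (∫ a in Set.Ioc (0:ℝ) 1, x ^ (-a) ∂μ)⁻¹ := by
  set K := μ.real (Set.Ioc 0 γ) / μ.real (Set.Ioc γ 1) + 1 with hK
  have hK0 : 0 < K := by positivity
  have hγ0 : 0 < γ := hγ.1
  refine ⟨K / γ, by positivity, fun x hx => ?_⟩
  set F := ∫ a in Set.Ioc (0:ℝ) 1, x ^ (-a) ∂μ with hF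
  have hxγ : 0 < x ^ γ := rpow_pos_of_pos hx.1 _
  have hvalue : ∫ τ in (0:ℝ)..x, K * (x ^ γ)⁻¹ * F⁻¹ * τ ^ (γ - 1) = K / γ * F⁻¹ := by
    rw [intervalIntegral.integral_const_mul, integral_rpow (Or.inl (by linarith)),
      sub_add_cancel, zero_rpow hγ0.ne']
    field_simp
    ring
  have hint : IntervalIntegrable (fun τ : ℝ => K * (x ^ γ)⁻¹ * F⁻¹ * τ ^ (γ - 1))
      volume 0 x :=
    (intervalIntegral.intervalIntegrable_rpow' (by linarith)).const_mul _
  rw [← hvalue, intervalIntegral.integral_of_le hx.1.le, intervalIntegral.integral_of_le hx.1.le]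
  refine integral_mono_of_nonneg ?_ hint.1 ?_
  · refine (ae_restrict_iff' measurableSet_Ioc).2 (.of_forall fun τ hτ => ?_)
    exact inv_nonneg.2 (integral_nonneg fun a => rpow_nonneg hτ.1.le _)
  · refine (ae_restrict_iff' measurableSet_Ioc).2 (.of_forall fun τ hτ => ?_)
    have hτ0 : 0 < τ := hτ.1
    have hτγ : 0 < τ ^ γ := rpow_pos_of_pos hτ0 _
    have hFpos : 0 < F := setIntegral_rpow_neg_pos μ hγ hγμ hx
    have hGpos := setIntegral_rpow_neg_pos μ hγ hγμ (x := τ) ⟨hτ0, hτ.2.trans hx.2⟩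
    have key := rpow_mul_setIntegral_rpow_neg_le μ hγ hγμ hx hτ
    simp only [setIntegral_rpow_one_sub μ hτ0]
    rw [← hK, ← hF, div_rpow hx.1.le hτ0.le, div_mul_eq_mul_div, div_le_iff₀ hτγ] at key
    rw [rpow_sub_one hτ0.ne', inv_le_iff_one_le_mul₀ (by positivity)]
    have heq : K * (x ^ γ)⁻¹ * F⁻¹ * (τ ^ γ / τ) *
        (τ * ∫ a in Set.Ioc (0:ℝ) 1, τ ^ (-a) ∂μ) =
        (K * (∫ a in Set.Ioc (0:ℝ) 1, τ ^ (-a) ∂μ) * τ ^ γ) / (x ^ γ * F) := by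
      field_simp
    rw [heq, one_le_div (by positivity)]
    exact key
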